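/- arXiv:2501.09324 — 5 statements merged into one kernel-verified Lean document; each statement's English description precedes it below -/
import Mathlib

section
/- Let h : ℝ^n → ℝ be continuous with h(x) ≤ B for all x ∈ ℝ^n for some B > 0, let α ∈ (0,1), and let {x_k} be a closed-loop trajectory of the system with deterministic initial state x_0 ∈ 𝓒 such that for every 0 ≤ k < K, on the event {x_0, …, x_k ∈ 𝓒}, 𝔼[h(x_{k+1}) | 𝓕_k] ≥ α h(x_k) almost surely. Then the K-step exit probability satisfies P(x_0, K) ≤ 1 − α^K h(x_0)/B. -/
open MeasureTheory ProbabilityTheory Matrix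

/-- The centered Gaussian distribution `N(0, Σ)` on `ℝ^n`, given by its density
`(2π)^{-n/2} (det Σ)^{-1/2} exp(-(1/2) wᵀ Σ⁻¹ w)` with respect to Lebesgue measure. -/
noncomputable def gaussianMeasure {n : ℕ} (S : Matrix (Fin n) (Fin n) ℝ) :
    Measure (Fin n → ℝ) :=
  (volume : Measure (Fin n → ℝ)).withDensity fun w =>
    ENNReal.ofReal ((2 * Real.pi) ^ (-(n : ℝ) / 2) * S.det ^ (-(1 : ℝ) / 2) *
      Real.exp (-(1 / 2 : ℝ) * (w ⬝ᵥ S⁻¹.mulVec w)))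

/-- The event that the real-valued process `Y` is nonnegative at all times up to `k`. -/
def nonnegUpTo {Ω : Type*} (Y : ℕ → Ω → ℝ) (k : ℕ) : Set Ω :=
  {ω | ∀ j, j ≤ k → 0 ≤ Y j ω}

lemma measurableSet_nonnegUpTo {Ω : Type*} {m0 : MeasurableSpace Ω} {𝓕 : Filtration ℕ m0}
    {Y : ℕ → Ω → ℝ} (hY : ∀ k, Measurable[𝓕 k] (Y k)) (k : ℕ) :
    MeasurableSet[𝓕 k] (nonnegUpTo Y k) := by
  have hset : nonnegUpTo Y k = ⋂ j, ⋂ _ : j ≤ k, Y j ⁻¹' Set.Ici 0 := by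
    ext ω
    simp [nonnegUpTo]
  rw [hset]
  exact MeasurableSet.iInter fun j => MeasurableSet.iInter fun hj =>
    𝓕.mono hj _ (hY j measurableSet_Ici)

lemma nonnegUpTo_succ_subset {Ω : Type*} (Y : ℕ → Ω → ℝ) (k : ℕ) :
    nonnegUpTo Y (k + 1) ⊆ nonnegUpTo Y k :=
  fun _ hω j hj => hω j (hj.trans k.le_succ)

lemma mul_setIntegral_nonnegUpTo_le_succ {Ω : Type*} {m0 : MeasurableSpace Ω} {μ : Measure Ω}
    [IsFiniteMeasure μ] {𝓕 : Filtration ℕ m0} {Y : ℕ → Ω → ℝ}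
    (hY : ∀ k, Measurable[𝓕 k] (Y k)) {α : ℝ} {k : ℕ}
    (hint : Integrable (Y k) μ) (hint' : Integrable (Y (k + 1)) μ)
    (hcond : ∀ᵐ ω ∂μ, ω ∈ nonnegUpTo Y k → α * Y k ω ≤ (μ[Y (k + 1) | 𝓕 k]) ω) :
    α * ∫ ω in nonnegUpTo Y k, Y k ω ∂μ ≤
      ∫ ω in nonnegUpTo Y (k + 1), Y (k + 1) ω ∂μ := by
  have hA := measurableSet_nonnegUpTo hY k
  have hA' := 𝓕.le k _ hA
  have hB' := 𝓕.le (k + 1) _ (measurableSet_nonnegUpTo hY (k + 1))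
  calc α * ∫ ω in nonnegUpTo Y k, Y k ω ∂μ
      = ∫ ω in nonnegUpTo Y k, α * Y k ω ∂μ := (integral_const_mul _ _).symm
    _ ≤ ∫ ω in nonnegUpTo Y k, (μ[Y (k + 1) | 𝓕 k]) ω ∂μ :=
        setIntegral_mono_on_ae (hint.const_mul α).integrableOn integrable_condExp.integrableOn
          hA' hcond
    _ = ∫ ω in nonnegUpTo Y k, Y (k + 1) ω ∂μ := setIntegral_condExp (𝓕.le k) hint' hA
    _ ≤ ∫ ω in nonnegUpTo Y (k + 1), Y (k + 1) ω ∂μ := by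
        rw [← integral_indicator hA', ← integral_indicator hB']
        refine integral_mono (hint'.indicator hA') (hint'.indicator hB') fun ω => ?_
        by_cases hω : ω ∈ nonnegUpTo Y (k + 1)
        · simp [hω, nonnegUpTo_succ_subset Y k hω]
        · by_cases hωk : ω ∈ nonnegUpTo Y k
          · have hneg : Y (k + 1) ω < 0 := by
              by_contra! hnn
              refine hω fun j hj => ?_
              rcases Nat.le_succ_iff.mp hj with hj | rfl
              · exact hωk j hj
              · exact hnn
            simpa [hω, hωk] using hneg.le
          · simp [hω, hωk]

lemma pow_mul_setIntegral_nonnegUpTo_zero_le {Ω : Type*} {m0 : MeasurableSpace Ω}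
    {μ : Measure Ω} [IsFiniteMeasure μ] {𝓕 : Filtration ℕ m0} {Y : ℕ → Ω → ℝ}
    (hY : ∀ k, Measurable[𝓕 k] (Y k)) {α : ℝ} (hα : 0 ≤ α) {K : ℕ}
    (hint : ∀ k, k ≤ K → Integrable (Y k) μ)
    (hcond : ∀ k, k < K →
      ∀ᵐ ω ∂μ, ω ∈ nonnegUpTo Y k → α * Y k ω ≤ (μ[Y (k + 1) | 𝓕 k]) ω) :
    α ^ K * ∫ ω in nonnegUpTo Y 0, Y 0 ω ∂μ ≤ ∫ ω in nonnegUpTo Y K, Y K ω ∂μ := by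
  induction K with
  | zero => simp
  | succ K ih =>
    rw [pow_succ', mul_assoc]
    exact (mul_le_mul_of_nonneg_left
      (ih (fun k hk => hint k (hk.trans K.le_succ)) fun k hk => hcond k (hk.trans K.lt_succ_self))
      hα).trans
      (mul_setIntegral_nonnegUpTo_le_succ hY (hint K K.le_succ) (hint _ le_rfl)
        (hcond K K.lt_succ_self))

/-- Theorem 1, first part (after Cosner et al.): for the closed-loop trajectory of
`x_{k+1} = f(x_k) + g(x_k) u_k + w_k` with `h ≤ B`, `α ∈ (0,1)`, and the discrete-time
CBF condition `𝔼[h(x_{k+1}) | 𝓕_k] ≥ α h(x_k)` holding (a.s.) on the event that the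
trajectory has stayed in the safe set `𝓒 = {h ≥ 0}` up to time `k`, the `K`-step exit
probability is bounded by `1 - α^K h(x_0)/B`. -/
theorem bounded_cbf_geometric_exit_bound
    {n m K : ℕ} {Ω : Type*} {m0 : MeasurableSpace Ω} {μ : Measure Ω}
    [IsProbabilityMeasure μ] (𝓕 : Filtration ℕ m0)
    (f : (Fin n → ℝ) → Fin n → ℝ) (g : (Fin n → ℝ) → Matrix (Fin n) (Fin m) ℝ)
    (hf : Continuous f) (hg : Continuous g)
    (u : ℕ → Ω → Fin m → ℝ) (w : ℕ → Ω → Fin n → ℝ) (x : ℕ → Ω → Fin n → ℝ)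
    (S : Matrix (Fin n) (Fin n) ℝ) (hS : S.IsSymm)
    (hu : ∀ k, Measurable[𝓕 k] (u k))
    (hw_meas : ∀ k, Measurable[𝓕 (k + 1)] (w k))
    (hw_indep : ∀ k, Indep (MeasurableSpace.comap (w k) inferInstance) (𝓕 k) μ)
    (hw_law : ∀ k, μ.map (w k) = gaussianMeasure S)
    (hx : Adapted 𝓕 x)
    (hdyn : ∀ k ω, x (k + 1) ω = f (x k ω) + (g (x k ω)).mulVec (u k ω) + w k ω)
    (h : (Fin n → ℝ) → ℝ) (hh : Continuous h)
    (B : ℝ) (hB : 0 < B) (hhB : ∀ y, h y ≤ B)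
    (α : ℝ) (hα : α ∈ Set.Ioo (0 : ℝ) 1)
    (x0 : Fin n → ℝ) (hx0 : ∀ ω, x 0 ω = x0) (hx0C : 0 ≤ h x0)
    (hint : ∀ k, k ≤ K → Integrable (fun ω => h (x k ω)) μ)
    (hcbf : ∀ k, k < K → ∀ᵐ ω ∂μ,
      (∀ j, j ≤ k → 0 ≤ h (x j ω)) →
        α * h (x k ω) ≤ (μ[fun ω' => h (x (k + 1) ω') | 𝓕 k]) ω) :
    μ {ω | ∃ k, k ≤ K ∧ h (x k ω) < 0} ≤ ENNReal.ofReal (1 - α ^ K * h x0 / B) := by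
  have hY : ∀ k, Measurable[𝓕 k] (fun ω => h (x k ω)) := fun k => hh.measurable.comp (hx k)
  have hpow := pow_mul_setIntegral_nonnegUpTo_zero_le hY hα.1.le hint hcbf
  set A := nonnegUpTo (fun k ω => h (x k ω)) K
  have hA : MeasurableSet A := 𝓕.le K _ (measurableSet_nonnegUpTo hY K)
  have hinit : nonnegUpTo (fun k ω => h (x k ω)) 0 = Set.univ := by
    ext ω
    simp [nonnegUpTo, hx0, hx0C]
  have hbound : ∫ ω in A, h (x K ω) ∂μ ≤ B * μ.real A := by
    calc ∫ ω in A, h (x K ω) ∂μ ≤ ∫ _ in A, B ∂μ :=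
          setIntegral_mono (hint K le_rfl).integrableOn (integrable_const B).integrableOn
            fun ω => hhB _
      _ = B * μ.real A := by simp [mul_comm]
  have hstay : α ^ K * h x0 / B ≤ μ.real A := by
    rw [div_le_iff₀' hB]
    simpa [hinit, hx0] using hpow.trans hbound
  have hexit : {ω | ∃ k, k ≤ K ∧ h (x k ω) < 0} = Aᶜ := by
    ext ω
    simp [A, nonnegUpTo]
  rw [hexit, ← ofReal_measureReal, probReal_compl_eq_one_sub hA]
  exact ENNReal.ofReal_le_ofReal (by linarith)
end

section
/- Let h : ℝ^n → ℝ be continuous with h(x) ≤ B for all x ∈ ℝ^n for some B > 0, let β ≥ 0, and let {x_k} be a closed-loop trajectory of the system with deterministic initial state x_0 ∈ 𝓒 such that for every 0 ≤ k < K, on the event {x_0, …, x_k ∈ 𝓒}, 𝔼[h(x_{k+1}) | 𝓕_k] ≥ h(x_k) + β almost surely. Then the K-step exit probability satisfies P(x_0, K) ≤ 1 − (h(x_0) − βK)/B. -/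
open MeasureTheory ProbabilityTheory Matrix

theorem measurableSet_staysNonneg {Ω : Type*} {m0 : MeasurableSpace Ω} {𝓕 : Filtration ℕ m0}
    {Y : ℕ → Ω → ℝ} (hY : Adapted 𝓕 Y) (k : ℕ) :
    MeasurableSet[𝓕 k] {ω | ∀ j, j ≤ k → 0 ≤ Y j ω} := by
  simp only [Set.ofPred_forall]
  exact MeasurableSet.iInter fun j => MeasurableSet.iInter fun hj =>
    𝓕.mono hj _ (hY j measurableSet_Ici)

/-- For a process `Y` that is a submartingale as long as it has stayed nonnegative, the expectation
of `Y k` restricted to the event that `Y` has stayed nonnegative is nondecreasing in `k`. -/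
theorem setIntegral_staysNonneg_le_succ {Ω : Type*} {m0 : MeasurableSpace Ω} {μ : Measure Ω}
    [IsFiniteMeasure μ] {𝓕 : Filtration ℕ m0} {Y : ℕ → Ω → ℝ} (hY : Adapted 𝓕 Y) {k : ℕ}
    (hk : Integrable (Y k) μ) (hk' : Integrable (Y (k + 1)) μ)
    (hsub : ∀ᵐ ω ∂μ, (∀ j, j ≤ k → 0 ≤ Y j ω) → Y k ω ≤ (μ[Y (k + 1) | 𝓕 k]) ω) :
    ∫ ω in {ω | ∀ j, j ≤ k → 0 ≤ Y j ω}, Y k ω ∂μ ≤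
      ∫ ω in {ω | ∀ j, j ≤ k + 1 → 0 ≤ Y j ω}, Y (k + 1) ω ∂μ := by
  have hA := measurableSet_staysNonneg hY k
  have hA0 := 𝓕.le k _ hA
  have hA' := 𝓕.le (k + 1) _ (measurableSet_staysNonneg hY (k + 1))
  calc ∫ ω in {ω | ∀ j, j ≤ k → 0 ≤ Y j ω}, Y k ω ∂μ
      ≤ ∫ ω in {ω | ∀ j, j ≤ k → 0 ≤ Y j ω}, (μ[Y (k + 1) | 𝓕 k]) ω ∂μ :=
        setIntegral_mono_on_ae hk.integrableOn integrable_condExp.integrableOn hA0 hsub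
    _ = ∫ ω in {ω | ∀ j, j ≤ k → 0 ≤ Y j ω}, Y (k + 1) ω ∂μ :=
        setIntegral_condExp (𝓕.le k) hk' hA
    _ ≤ ∫ ω in {ω | ∀ j, j ≤ k + 1 → 0 ≤ Y j ω}, Y (k + 1) ω ∂μ := by
        rw [← integral_indicator hA0, ← integral_indicator hA']
        refine integral_mono (hk'.indicator hA0) (hk'.indicator hA') fun ω => ?_
        simp only [Set.indicator_apply, Set.mem_ofPred_eq]
        split_ifs with h1 h2 h2
        · exact le_rfl
        · by_contra! hneg
          refine h2 fun j hj => ?_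
          rcases Nat.le_succ_iff.1 hj with hj | rfl
          exacts [h1 j hj, hneg.le]
        · exact absurd (fun j hj => h2 j (Nat.le_succ_of_le hj)) h1
        · exact le_rfl

/-- Exit bound for a process bounded above by `B` that is a submartingale as long as it has stayed
nonnegative. -/
theorem measure_exists_neg_le_of_le {Ω : Type*} {m0 : MeasurableSpace Ω} {μ : Measure Ω}
    [IsProbabilityMeasure μ] {𝓕 : Filtration ℕ m0} {Y : ℕ → Ω → ℝ} (hY : Adapted 𝓕 Y)
    {K : ℕ} {B y : ℝ} (hB : 0 < B) (hYB : ∀ ω, Y K ω ≤ B) (hy : 0 ≤ y) (hY0 : ∀ ω, Y 0 ω = y)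
    (hint : ∀ k, k ≤ K → Integrable (Y k) μ)
    (hsub : ∀ k, k < K → ∀ᵐ ω ∂μ,
      (∀ j, j ≤ k → 0 ≤ Y j ω) → Y k ω ≤ (μ[Y (k + 1) | 𝓕 k]) ω) :
    μ {ω | ∃ k, k ≤ K ∧ Y k ω < 0} ≤ ENNReal.ofReal (1 - y / B) := by
  have key : ∀ k, k ≤ K → y ≤ ∫ ω in {ω | ∀ j, j ≤ k → 0 ≤ Y j ω}, Y k ω ∂μ := by
    intro k
    induction k with
    | zero => intro _; simp [hY0, hy]
    | succ k ih =>
      intro hk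
      exact (ih (by omega)).trans (setIntegral_staysNonneg_le_succ hY (hint k (by omega))
        (hint (k + 1) hk) (hsub k (by omega)))
  have hA := 𝓕.le K _ (measurableSet_staysNonneg hY K)
  have hyA : y ≤ μ.real {ω | ∀ j, j ≤ K → 0 ≤ Y j ω} * B := by
    refine (key K le_rfl).trans ?_
    have hle := setIntegral_mono_on (hint K le_rfl).integrableOn
      (integrable_const (μ := μ) B).integrableOn hA fun ω _ => hYB ω
    rwa [setIntegral_const, smul_eq_mul] at hle
  have hcompl : {ω | ∃ k, k ≤ K ∧ Y k ω < 0} = {ω | ∀ j, j ≤ K → 0 ≤ Y j ω}ᶜ := by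
    ext ω
    simp
  rw [hcompl, ← ofReal_measureReal, probReal_compl_eq_one_sub hA]
  refine ENNReal.ofReal_le_ofReal (sub_le_sub_left ?_ 1)
  rwa [div_le_iff₀ hB]

/-- Theorem 1, second part (after Cosner et al.): for the closed-loop trajectory of
`x_{k+1} = f(x_k) + g(x_k) u_k + w_k` with `h ≤ B`, `β ≥ 0`, and the c-martingale
condition `𝔼[h(x_{k+1}) | 𝓕_k] ≥ h(x_k) + β` holding (a.s.) on the event that the
trajectory has stayed in the safe set `𝓒 = {h ≥ 0}` up to time `k`, the `K`-step exit
probability is bounded by `1 - (h(x_0) - βK)/B`. -/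
theorem bounded_cbf_cmartingale_exit_bound
    {n m K : ℕ} {Ω : Type*} {m0 : MeasurableSpace Ω} {μ : Measure Ω}
    [IsProbabilityMeasure μ] (𝓕 : Filtration ℕ m0)
    (f : (Fin n → ℝ) → Fin n → ℝ) (g : (Fin n → ℝ) → Matrix (Fin n) (Fin m) ℝ)
    (hf : Continuous f) (hg : Continuous g)
    (u : ℕ → Ω → Fin m → ℝ) (w : ℕ → Ω → Fin n → ℝ) (x : ℕ → Ω → Fin n → ℝ)
    (S : Matrix (Fin n) (Fin n) ℝ) (hS : S.IsSymm)
    (hu : ∀ k, Measurable[𝓕 k] (u k))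
    (hw_meas : ∀ k, Measurable[𝓕 (k + 1)] (w k))
    (hw_indep : ∀ k, Indep (MeasurableSpace.comap (w k) inferInstance) (𝓕 k) μ)
    (hw_law : ∀ k, μ.map (w k) = gaussianMeasure S)
    (hx : Adapted 𝓕 x)
    (hdyn : ∀ k ω, x (k + 1) ω = f (x k ω) + (g (x k ω)).mulVec (u k ω) + w k ω)
    (h : (Fin n → ℝ) → ℝ) (hh : Continuous h)
    (B : ℝ) (hB : 0 < B) (hhB : ∀ y, h y ≤ B)
    (β : ℝ) (hβ : 0 ≤ β)
    (x0 : Fin n → ℝ) (hx0 : ∀ ω, x 0 ω = x0) (hx0C : 0 ≤ h x0)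
    (hint : ∀ k, k ≤ K → Integrable (fun ω => h (x k ω)) μ)
    (hcbf : ∀ k, k < K → ∀ᵐ ω ∂μ,
      (∀ j, j ≤ k → 0 ≤ h (x j ω)) →
        h (x k ω) + β ≤ (μ[fun ω' => h (x (k + 1) ω') | 𝓕 k]) ω) :
    μ {ω | ∃ k, k ≤ K ∧ h (x k ω) < 0} ≤ ENNReal.ofReal (1 - (h x0 - β * K) / B) := by
  have hbound : μ {ω | ∃ k, k ≤ K ∧ h (x k ω) < 0} ≤ ENNReal.ofReal (1 - h x0 / B) :=
    measure_exists_neg_le_of_le (𝓕 := 𝓕) (Y := fun k ω => h (x k ω))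
      (fun k => hh.measurable.comp (hx k)) hB (fun ω => hhB _) hx0C (fun ω => by rw [hx0]) hint
      fun k hk => (hcbf k hk).mono fun ω hω hsafe =>
        (le_add_of_nonneg_right hβ).trans (hω hsafe)
  refine hbound.trans (ENNReal.ofReal_le_ofReal ?_)
  have hβK : 0 ≤ β * K := by positivity
  gcongr
  linarith
end

section
/- Stopped process is a nonnegative supermartingale: Let h : ℝ^n → ℝ be continuous, let Φ : ℝ × {0,1,…,K} → ℝ be continuous with Φ(·, k) decreasing and Φ(s, k) ≥ 0 for all s ∈ ℝ and 0 ≤ k ≤ K, and let {x_k} be an adapted process such that for every 0 ≤ k < K, on the event {x_0, …, x_k ∈ 𝓒}, 𝔼[Φ(h(x_{k+1}), k+1) | 𝓕_k] ≤ Φ(h(x_k), k) almost surely. Let τ = min{ k ∈ ℤ≥0 : x_k ∉ 𝓒 } (with min ∅ = ∞). Then the stopped process W_k = Φ(h(x_{k∧τ∧K}), k∧τ∧K), k ∈ ℤ≥0, is a nonnegative supermartingale with respect to {𝓕_k}. -/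
open MeasureTheory ProbabilityTheory

open Classical in
/-- The index `k ∧ τ ∧ K`, where `τ = min{ j : x_j ∉ 𝓒 } = min{ j : h(x_j) < 0 }`
(with `min ∅ = ∞`) is the exit time from the safe set `𝓒 = {h ≥ 0}`. -/
noncomputable def stoppedIdx {n : ℕ} {Ω : Type*} (h : (Fin n → ℝ) → ℝ)
    (x : ℕ → Ω → Fin n → ℝ) (K : ℕ) (k : ℕ) (ω : Ω) : ℕ :=
  min k (if hev : ∃ j, h (x j ω) < 0 then min (Nat.find hev) K else K)

section StoppedIdx

variable {n : ℕ} {Ω : Type*} {h : (Fin n → ℝ) → ℝ} {x : ℕ → Ω → Fin n → ℝ} {K k : ℕ} {ω : Ω}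

theorem stoppedIdx_le_horizon : stoppedIdx h x K k ω ≤ K := by
  unfold stoppedIdx
  split_ifs
  · exact (min_le_right _ _).trans (min_le_right _ _)
  · exact min_le_right _ _

theorem stoppedIdx_zero : stoppedIdx h x K 0 ω = 0 := by
  simp [stoppedIdx]

theorem stoppedIdx_succ_of_horizon_le (hk : K ≤ k) :
    stoppedIdx h x K (k + 1) ω = stoppedIdx h x K k ω := by
  unfold stoppedIdx
  split_ifs <;> omega

theorem stoppedIdx_eq_self (hk : k ≤ K) (hsafe : ∀ j < k, 0 ≤ h (x j ω)) :
    stoppedIdx h x K k ω = k := by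
  classical
  unfold stoppedIdx
  split_ifs with hev
  · have : k ≤ Nat.find hev := (Nat.le_find_iff _ _).2 fun j hj => not_lt.2 (hsafe j hj)
    omega
  · omega

theorem stoppedIdx_succ_of_exited (hexit : ¬∀ j ≤ k, 0 ≤ h (x j ω)) :
    stoppedIdx h x K (k + 1) ω = stoppedIdx h x K k ω := by
  classical
  push Not at hexit
  obtain ⟨j, hjk, hj⟩ := hexit
  have hev : ∃ j, h (x j ω) < 0 := ⟨j, hj⟩
  have : Nat.find hev ≤ j := Nat.find_min' hev hj
  simp only [stoppedIdx, dif_pos hev]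
  omega

/-- Before the horizon, the stopped process moves exactly on the event of still being safe. -/
theorem stopped_succ_eq_add_indicator (Y : ℕ → Ω → ℝ) (hk : k < K) :
    (fun ω => Y (stoppedIdx h x K (k + 1) ω) ω) =
      (fun ω => Y (stoppedIdx h x K k ω) ω) +
        {ω | ∀ j ≤ k, 0 ≤ h (x j ω)}.indicator (Y (k + 1) - Y k) := by
  funext ω
  by_cases hsafe : ∀ j ≤ k, 0 ≤ h (x j ω)
  · have hmem : ω ∈ {ω | ∀ j ≤ k, 0 ≤ h (x j ω)} := hsafe
    simp [Set.indicator_of_mem hmem, stoppedIdx_eq_self hk fun j hj => hsafe j (by omega),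
      stoppedIdx_eq_self hk.le fun j hj => hsafe j hj.le]
  · have hmem : ω ∉ {ω | ∀ j ≤ k, 0 ≤ h (x j ω)} := hsafe
    simp [Set.indicator_of_notMem hmem, stoppedIdx_succ_of_exited hsafe]

theorem measurableSet_safe {m0 : MeasurableSpace Ω} {𝓕 : Filtration ℕ m0}
    (hx : Adapted 𝓕 x) (hh : Measurable h) (k : ℕ) :
    MeasurableSet[𝓕 k] {ω | ∀ j ≤ k, 0 ≤ h (x j ω)} := by
  simp only [Set.ofPred_forall]
  exact MeasurableSet.iInter fun j => MeasurableSet.iInter fun hj =>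
    (hh.comp ((hx j).mono (𝓕.mono hj) le_rfl)) measurableSet_Ici

theorem supermartingale_stoppedIdx {m0 : MeasurableSpace Ω} {μ : Measure Ω} [IsFiniteMeasure μ]
    {𝓕 : Filtration ℕ m0} (hx : Adapted 𝓕 x) (hh : Measurable h) {Y : ℕ → Ω → ℝ}
    (hY : ∀ k ≤ K, StronglyMeasurable[𝓕 k] (Y k)) (hint : ∀ k ≤ K, Integrable (Y k) μ)
    (hstep : ∀ k < K, ∀ᵐ ω ∂μ, (∀ j ≤ k, 0 ≤ h (x j ω)) → (μ[Y (k + 1) | 𝓕 k]) ω ≤ Y k ω) :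
    Supermartingale (fun k ω => Y (stoppedIdx h x K k ω) ω) 𝓕 μ := by
  have hfrozen : ∀ k, K ≤ k → (fun ω => Y (stoppedIdx h x K (k + 1) ω) ω) =
      fun ω => Y (stoppedIdx h x K k ω) ω := fun k hk => by
    simp only [stoppedIdx_succ_of_horizon_le hk]
  have hmeas : ∀ k, StronglyMeasurable[𝓕 k] fun ω => Y (stoppedIdx h x K k ω) ω := by
    intro k
    induction k with
    | zero => simpa only [stoppedIdx_zero] using hY 0 (Nat.zero_le K)
    | succ k ih =>
      have ih' := ih.mono (𝓕.mono k.le_succ)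
      rcases lt_or_ge k K with hk | hk
      · rw [stopped_succ_eq_add_indicator Y hk]
        exact ih'.add (((hY (k + 1) hk).sub ((hY k hk.le).mono (𝓕.mono k.le_succ))).indicator
          (𝓕.mono k.le_succ _ (measurableSet_safe hx hh k)))
      · rwa [hfrozen k hk]
  have hincr : ∀ k < K, Integrable (Y (k + 1) - Y k) μ := fun k hk =>
    (hint (k + 1) hk).sub (hint k hk.le)
  have hinteg : ∀ k, Integrable (fun ω => Y (stoppedIdx h x K k ω) ω) μ := by
    intro k
    induction k with
    | zero => simpa only [stoppedIdx_zero] using hint 0 (Nat.zero_le K)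
    | succ k ih =>
      rcases lt_or_ge k K with hk | hk
      · rw [stopped_succ_eq_add_indicator Y hk]
        exact ih.add ((hincr k hk).indicator (𝓕.le k _ (measurableSet_safe hx hh k)))
      · rwa [hfrozen k hk]
  refine supermartingale_nat hmeas hinteg fun k => ?_
  have hself := condExp_of_stronglyMeasurable (𝓕.le k) (hmeas k) (hinteg k)
  rcases lt_or_ge k K with hk | hk
  · have hsafe := measurableSet_safe hx hh k
    rw [stopped_succ_eq_add_indicator Y hk]
    filter_upwards [condExp_add (hinteg k) ((hincr k hk).indicator (𝓕.le k _ hsafe)) (𝓕 k),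
      condExp_indicator (hincr k hk) hsafe,
      condExp_sub (hint (k + 1) hk) (hint k hk.le) (𝓕 k), hstep k hk] with ω hadd hind hsub hω
    rw [hadd, Pi.add_apply, hself, hind]
    refine add_le_of_nonpos_right (Set.indicator_apply_nonpos fun hmem => ?_)
    rw [hsub, Pi.sub_apply,
      condExp_of_stronglyMeasurable (𝓕.le k) (hY k hk.le) (hint k hk.le)]
    exact sub_nonpos.2 (hω hmem)
  · rw [hfrozen k hk, hself]

end StoppedIdx

/-- **The stopped process is a nonnegative supermartingale**: if `x` is adapted and the
supermartingale-type CBF condition holds (a.s., on the event that the trajectory has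
stayed in `𝓒 = {h ≥ 0}` up to time `k`) for every `0 ≤ k < K`, then
`W_k = Φ(h(x_{k∧τ∧K}), k∧τ∧K)` is a nonnegative supermartingale with respect to `𝓕`. -/
theorem stopped_process_nonneg_supermartingale
    {n K : ℕ} {Ω : Type*} {m0 : MeasurableSpace Ω} {μ : Measure Ω}
    [IsProbabilityMeasure μ] (𝓕 : Filtration ℕ m0)
    (x : ℕ → Ω → Fin n → ℝ) (hx : Adapted 𝓕 x)
    (h : (Fin n → ℝ) → ℝ) (hh : Continuous h)
    (Φ : ℝ → ℕ → ℝ)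
    (hΦcont : ∀ k, k ≤ K → Continuous fun s => Φ s k)
    (hΦanti : ∀ k, k ≤ K → StrictAnti fun s => Φ s k)
    (hΦnn : ∀ s : ℝ, ∀ k, k ≤ K → 0 ≤ Φ s k)
    (hint : ∀ k, k ≤ K → Integrable (fun ω => Φ (h (x k ω)) k) μ)
    (hcbf : ∀ k, k < K → ∀ᵐ ω ∂μ,
      (∀ j, j ≤ k → 0 ≤ h (x j ω)) →
        (μ[fun ω' => Φ (h (x (k + 1) ω')) (k + 1) | 𝓕 k]) ω ≤ Φ (h (x k ω)) k) :
    Supermartingale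
      (fun k ω => Φ (h (x (stoppedIdx h x K k ω) ω)) (stoppedIdx h x K k ω)) 𝓕 μ ∧
    ∀ k, ∀ ω, 0 ≤ Φ (h (x (stoppedIdx h x K k ω) ω)) (stoppedIdx h x K k ω) := by
  have hY : ∀ k ≤ K, StronglyMeasurable[𝓕 k] fun ω => Φ (h (x k ω)) k := fun k hk =>
    ((hΦcont k hk).measurable.comp (hh.measurable.comp (hx k))).stronglyMeasurable
  exact ⟨supermartingale_stoppedIdx (Y := fun k ω => Φ (h (x k ω)) k) hx hh.measurable hY hint hcbf,
    fun k ω => hΦnn _ _ stoppedIdx_le_horizon⟩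
end

section
/- Bounded-CBF exit bound: Let h : ℝ^n → ℝ be continuous with h(x) ≤ B for all x ∈ ℝ^n, let Ψ : ℝ → ℝ be nonnegative, continuous, and decreasing on (−∞, 0], with Ψ(−B) > 0, and let β ≥ 0. Let {x_k} be a closed-loop trajectory of the system with deterministic initial state x_0 ∈ 𝓒 such that for every 0 ≤ k < K, on the event {x_0, …, x_k ∈ 𝓒}, 𝔼[Ψ(h(x_{k+1}) − B) | 𝓕_k] ≤ Ψ(h(x_k) − B) + β almost surely. Then the function Φ(s, k) = Ψ(s − B) + (K − k)β satisfies the supermartingale-type condition, and the K-step exit probability satisfies P(x_0, K) ≤ (Ψ(h(x_0) − B) + Kβ) / Ψ(−B). -/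
open MeasureTheory ProbabilityTheory Matrix

/-- A maximal inequality for a sequence `Y` that grows by at most `β` in conditional mean on the
events `A k` and is at least `c` where `A k` is left. -/
theorem mul_measureReal_compl_add_setIntegral_le
    {Ω : Type*} {m0 : MeasurableSpace Ω} {μ : Measure Ω} [IsProbabilityMeasure μ]
    (𝓕 : Filtration ℕ m0) {A : ℕ → Set Ω} (hA : ∀ k, MeasurableSet[𝓕 k] (A k))
    (hAanti : Antitone A) (hA0 : A 0 = Set.univ) {Y : ℕ → Ω → ℝ} {K : ℕ} {β c : ℝ} (hβ : 0 ≤ β)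
    (hY : ∀ k, k ≤ K → Integrable (Y k) μ)
    (hstep : ∀ k, k < K → ∀ᵐ ω ∂μ, ω ∈ A k → (μ[Y (k + 1) | 𝓕 k]) ω ≤ Y k ω + β)
    (hc : ∀ k, ∀ ω ∈ A k \ A (k + 1), c ≤ Y (k + 1) ω) :
    ∀ k, k ≤ K → c * μ.real (A k)ᶜ + ∫ ω in A k, Y k ω ∂μ ≤ ∫ ω, Y 0 ω ∂μ + k * β := by
  have hAm : ∀ k, MeasurableSet (A k) := fun k => 𝓕.le k _ (hA k)
  intro k
  induction k with
  | zero => simp [hA0]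
  | succ k ih =>
    intro hk
    have hYk := hY k (by lia)
    have hYs := hY (k + 1) hk
    have hdrift : ∫ ω in A k, Y (k + 1) ω ∂μ ≤ ∫ ω in A k, Y k ω ∂μ + β := by
      calc ∫ ω in A k, Y (k + 1) ω ∂μ = ∫ ω in A k, (μ[Y (k + 1) | 𝓕 k]) ω ∂μ :=
            (setIntegral_condExp (𝓕.le k) hYs (hA k)).symm
        _ ≤ ∫ ω in A k, (Y k ω + β) ∂μ :=
            setIntegral_mono_on_ae integrable_condExp.integrableOn
              (hYk.add (integrable_const β)).integrableOn (hAm k) (hstep k (by lia))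
        _ = ∫ ω in A k, Y k ω ∂μ + μ.real (A k) * β := by
            rw [integral_add hYk.integrableOn (integrable_const β).integrableOn,
              setIntegral_const, smul_eq_mul]
        _ ≤ ∫ ω in A k, Y k ω ∂μ + β := by
            gcongr
            exact mul_le_of_le_one_left hβ measureReal_le_one
    have hsub : A (k + 1) ⊆ A k := hAanti k.le_succ
    have hexit : c * μ.real (A k \ A (k + 1)) ≤ ∫ ω in A k \ A (k + 1), Y (k + 1) ω ∂μ :=
      setIntegral_ge_of_const_le_real ((hAm k).diff (hAm (k + 1))) (measure_ne_top _ _) (hc k)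
        hYs.integrableOn
    have hsplit : ∫ ω in A k \ A (k + 1), Y (k + 1) ω ∂μ =
        ∫ ω in A k, Y (k + 1) ω ∂μ - ∫ ω in A (k + 1), Y (k + 1) ω ∂μ :=
      setIntegral_sdiff (hAm (k + 1)) hYs.integrableOn hsub
    have hmeas := measureReal_sdiff (μ := μ) hsub (hAm (k + 1))
    have hcompl := probReal_compl_eq_one_sub (μ := μ) (hAm k)
    have hcompl' := probReal_compl_eq_one_sub (μ := μ) (hAm (k + 1))
    rw [hmeas] at hexit
    rw [hcompl']
    have hprev := ih (by lia)
    rw [hcompl] at hprev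
    push_cast
    linarith

/-- **Bounded-CBF exit bound** (Proposition 4): with `h ≤ B`, `Ψ` nonnegative, continuous,
decreasing on `(-∞, 0]`, `Ψ(-B) > 0`, `β ≥ 0`, and the one-step condition
`𝔼[Ψ(h(x_{k+1}) - B) | 𝓕_k] ≤ Ψ(h(x_k) - B) + β` holding (a.s.) on the event that the
trajectory has stayed in the safe set `𝓒 = {h ≥ 0}` up to time `k`, the function
`Φ(s,k) = Ψ(s - B) + (K - k)β` satisfies the supermartingale-type condition, and the
`K`-step exit probability is bounded by `(Ψ(h(x_0) - B) + Kβ) / Ψ(-B)`. -/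
theorem bounded_cbf_psi_exit_bound
    {n m K : ℕ} {Ω : Type*} {m0 : MeasurableSpace Ω} {μ : Measure Ω}
    [IsProbabilityMeasure μ] (𝓕 : Filtration ℕ m0)
    (f : (Fin n → ℝ) → Fin n → ℝ) (g : (Fin n → ℝ) → Matrix (Fin n) (Fin m) ℝ)
    (hf : Continuous f) (hg : Continuous g)
    (u : ℕ → Ω → Fin m → ℝ) (w : ℕ → Ω → Fin n → ℝ) (x : ℕ → Ω → Fin n → ℝ)
    (S : Matrix (Fin n) (Fin n) ℝ) (hS : S.IsSymm)
    (hu : ∀ k, Measurable[𝓕 k] (u k))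
    (hw_meas : ∀ k, Measurable[𝓕 (k + 1)] (w k))
    (hw_indep : ∀ k, Indep (MeasurableSpace.comap (w k) inferInstance) (𝓕 k) μ)
    (hw_law : ∀ k, μ.map (w k) = gaussianMeasure S)
    (hx : Adapted 𝓕 x)
    (hdyn : ∀ k ω, x (k + 1) ω = f (x k ω) + (g (x k ω)).mulVec (u k ω) + w k ω)
    (h : (Fin n → ℝ) → ℝ) (hh : Continuous h)
    (B : ℝ) (hhB : ∀ y, h y ≤ B)
    (Ψ : ℝ → ℝ) (hΨnn : ∀ s, 0 ≤ Ψ s) (hΨcont : Continuous Ψ)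
    (hΨanti : StrictAntiOn Ψ (Set.Iic (0 : ℝ))) (hΨB : 0 < Ψ (-B))
    (β : ℝ) (hβ : 0 ≤ β)
    (x0 : Fin n → ℝ) (hx0 : ∀ ω, x 0 ω = x0) (hx0C : 0 ≤ h x0)
    (hint : ∀ k, k ≤ K → Integrable (fun ω => Ψ (h (x k ω) - B)) μ)
    (hcbf : ∀ k, k < K → ∀ᵐ ω ∂μ,
      (∀ j, j ≤ k → 0 ≤ h (x j ω)) →
        (μ[fun ω' => Ψ (h (x (k + 1) ω') - B) | 𝓕 k]) ω ≤ Ψ (h (x k ω) - B) + β) :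
    (∀ k, k < K → ∀ᵐ ω ∂μ,
      (∀ j, j ≤ k → 0 ≤ h (x j ω)) →
        (μ[fun ω' => Ψ (h (x (k + 1) ω') - B) + ((K - (k + 1) : ℕ) : ℝ) * β | 𝓕 k]) ω ≤
          Ψ (h (x k ω) - B) + ((K - k : ℕ) : ℝ) * β) ∧
    μ {ω | ∃ k, k ≤ K ∧ h (x k ω) < 0} ≤
      ENNReal.ofReal ((Ψ (h x0 - B) + (K : ℝ) * β) / Ψ (-B)) := by
  have hhx : ∀ k, Measurable[𝓕 k] fun ω => h (x k ω) := fun k => hh.measurable.comp (hx k)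
  refine ⟨fun k hk => ?_, ?_⟩
  · have hadd := condExp_add (hint (k + 1) hk)
      (integrable_const (μ := μ) (((K - (k + 1) : ℕ) : ℝ) * β)) (𝓕 k)
    rw [condExp_const (𝓕.le k)] at hadd
    filter_upwards [hadd, hcbf k hk] with ω hω hω' hsafe
    have hcast : ((K - k : ℕ) : ℝ) = ((K - (k + 1) : ℕ) : ℝ) + 1 := by
      exact_mod_cast (by lia : K - k = K - (k + 1) + 1)
    refine hω.le.trans ?_
    rw [Pi.add_apply, hcast]
    linarith [hω' hsafe]
  · let A : ℕ → Set Ω := fun k => {ω | ∀ j, j ≤ k → 0 ≤ h (x j ω)}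
    have hA : ∀ k, MeasurableSet[𝓕 k] (A k) := fun k => by
      simp only [A, Set.ofPred_forall]
      exact MeasurableSet.iInter fun j => MeasurableSet.iInter fun hj =>
        𝓕.mono hj _ (measurableSet_le measurable_const (hhx j))
    have hAanti : Antitone A := fun i j hij ω hω l hl => hω l (hl.trans hij)
    have hA0 : A 0 = Set.univ := Set.eq_univ_of_forall fun ω j hj => by
      rwa [Nat.le_zero.mp hj, hx0]
    have hB : 0 ≤ B := hx0C.trans (hhB x0)
    have hc : ∀ k, ∀ ω ∈ A k \ A (k + 1), Ψ (-B) ≤ Ψ (h (x (k + 1) ω) - B) := by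
      rintro k ω ⟨hin, hout⟩
      have hneg : h (x (k + 1) ω) < 0 := by
        by_contra! hnn
        refine hout fun j hj => ?_
        rcases Nat.le_succ_iff.mp hj with hj | rfl
        exacts [hin j hj, hnn]
      exact hΨanti.antitoneOn (Set.mem_Iic.mpr (by linarith)) (Set.mem_Iic.mpr (by linarith))
        (by linarith)
    have hmax := mul_measureReal_compl_add_setIntegral_le 𝓕 hA hAanti hA0 hβ hint hcbf hc K le_rfl
    have hnonneg : 0 ≤ ∫ ω in A K, Ψ (h (x K ω) - B) ∂μ := integral_nonneg fun ω => hΨnn _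
    have hinit : ∫ ω, Ψ (h (x 0 ω) - B) ∂μ = Ψ (h x0 - B) := by simp [hx0]
    have hset : {ω | ∃ k, k ≤ K ∧ h (x k ω) < 0} = (A K)ᶜ := by
      ext ω
      simp [A]
    rw [hset, ← ofReal_measureReal]
    refine ENNReal.ofReal_le_ofReal ((le_div_iff₀' hΨB).mpr ?_)
    linarith
end

section
/- Quadratic-CBF exit bound: Let h(x) = xᵀ A x + bᵀ x + c with A ∈ ℝ^{n×n} symmetric, b ∈ ℝ^n, c ∈ ℝ, and suppose the covariance matrix Σ of the Gaussian disturbance is symmetric positive definite with Λ = (1/2)Σ^{-1} + A positive definite. Define Θ(F) = (AF + b/2)ᵀ Λ^{-1} (AF + b/2) and M = (1/2) log det(I + 2ΣA), and let β ≥ 0. Let {x_k} be a closed-loop trajectory of the system with deterministic initial state x_0 ∈ 𝓒 such that for every 0 ≤ k < K, on the event {x_0, …, x_k ∈ 𝓒}, writing F_k = f(x_k) + g(x_k)u_k, it holds almost surely that h(F_k) − Θ(F_k) ≥ −log(exp(−h(x_k)) + β) − M. Then the K-step exit probability satisfies P(x_0, K) ≤ exp(−h(x_0)) + Kβ. -/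
open MeasureTheory ProbabilityTheory Matrix

theorem lintegral_exp_neg_dotProduct_self (n : ℕ) :
    ∫⁻ y : Fin n → ℝ, ENNReal.ofReal (Real.exp (-(y ⬝ᵥ y))) =
      ENNReal.ofReal (√Real.pi ^ n) := by
  have hrw : ∀ y : Fin n → ℝ, Real.exp (-(y ⬝ᵥ y)) = ∏ i, Real.exp (-1 * y i ^ 2) := by
    intro y
    rw [← Real.exp_sum, dotProduct, ← Finset.sum_neg_distrib]
    exact congrArg Real.exp (Finset.sum_congr rfl fun i _ => by ring)
  have hintegrable : Integrable fun y : Fin n → ℝ => ∏ i, Real.exp (-1 * y i ^ 2) :=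
    Integrable.fintype_prod fun _ => integrable_exp_neg_mul_sq one_pos
  simp_rw [hrw]
  rw [← ofReal_integral_eq_lintegral_ofReal hintegrable
      (ae_of_all _ fun y => Finset.prod_nonneg fun i _ => (Real.exp_pos _).le),
    integral_fintype_prod_volume_eq_pow (fun t : ℝ => Real.exp (-1 * t ^ 2)),
    integral_gaussian, div_one, Fintype.card_fin]

theorem lintegral_exp_neg_quadratic {n : ℕ} {L : Matrix (Fin n) (Fin n) ℝ} (hL : L.PosDef) :
    ∫⁻ y : Fin n → ℝ, ENNReal.ofReal (Real.exp (-(y ⬝ᵥ L.mulVec y))) =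
      ENNReal.ofReal (√Real.pi ^ n * (√L.det)⁻¹) := by
  obtain ⟨B, hB⟩ : ∃ B : Matrix (Fin n) (Fin n) ℝ, L = Bᵀ * B := by
    open scoped MatrixOrder in
    obtain ⟨B, hB⟩ := CStarAlgebra.nonneg_iff_eq_star_mul_self.mp hL.posSemidef.nonneg
    exact ⟨B, by rw [hB, star_eq_conjTranspose, conjTranspose_eq_transpose_of_trivial]⟩
  have hdet : L.det = B.det ^ 2 := by rw [hB, det_mul, det_transpose, sq]
  have hB0 : B.det ≠ 0 := fun h0 => hL.det_pos.ne' (by simp [hdet, h0])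
  have hquad : ∀ y, y ⬝ᵥ L.mulVec y = toLin' B y ⬝ᵥ toLin' B y := by
    intro y
    rw [hB, toLin'_apply, ← mulVec_mulVec, dotProduct_mulVec, vecMul_transpose]
  have hmeas : Measurable (toLin' B) := (LinearMap.continuous_on_pi _).measurable
  have hcont : Measurable fun y : Fin n → ℝ => ENNReal.ofReal (Real.exp (-(y ⬝ᵥ y))) := by
    unfold dotProduct
    fun_prop
  simp_rw [hquad]
  rw [← lintegral_map (f := fun y : Fin n → ℝ => ENNReal.ofReal (Real.exp (-(y ⬝ᵥ y))))
      hcont hmeas, Real.map_matrix_volume_pi_eq_smul_volume_pi hB0, lintegral_smul_measure,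
    lintegral_exp_neg_dotProduct_self, hdet, Real.sqrt_sq_eq_abs, smul_eq_mul,
    ← ENNReal.ofReal_mul (abs_nonneg _), abs_inv, mul_comm]

/-- Freezing an `m`-measurable variable while integrating out noise independent of `m`. -/
theorem setLIntegral_add_of_indep {E Ω : Type*} [MeasurableSpace E] [Add E] [MeasurableAdd₂ E]
    {m m0 : MeasurableSpace Ω} {μ : Measure Ω} [IsProbabilityMeasure μ] (hm : m ≤ m0)
    {s : Set Ω} (hs : MeasurableSet[m] s) {Y W : Ω → E} (hY : Measurable[m] Y)
    (hW : Measurable W) (hind : Indep (MeasurableSpace.comap W inferInstance) m μ)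
    {φ : E → ENNReal} (hφ : Measurable φ) :
    ∫⁻ ω in s, φ (Y ω + W ω) ∂μ = ∫⁻ ω in s, ∫⁻ z, φ (Y ω + z) ∂(μ.map W) ∂μ := by
  let ind : Ω → ENNReal := s.indicator 1
  have hind_meas : Measurable[m] ind := Measurable.indicator (m := m) measurable_const hs
  let P : Ω → ENNReal × E := fun ω => (ind ω, Y ω)
  have hP : Measurable[m] P := hind_meas.prodMk hY
  have hPW : IndepFun P W μ := by
    rw [IndepFun_iff_Indep]
    exact indep_of_indep_of_le_left hind.symm hP.comap_le
  have hP0 : Measurable P := hP.mono hm le_rfl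
  have hprod := hPW.map_prod_eq_prod_map_map hP0.aemeasurable hW.aemeasurable
  have : IsProbabilityMeasure (μ.map W) := Measure.isProbabilityMeasure_map hW.aemeasurable
  have hψ : Measurable fun p : (ENNReal × E) × E => p.1.1 * φ (p.1.2 + p.2) := by fun_prop
  have hind_mul : ∀ (a : Ω → ENNReal), s.indicator a = fun ω => ind ω * a ω := by
    intro a
    ext ω
    by_cases hω : ω ∈ s <;> simp [ind, hω]
  have hG : Measurable fun p : ENNReal × E => ∫⁻ z, p.1 * φ (p.2 + z) ∂(μ.map W) :=
    hψ.lintegral_prod_right'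
  rw [← lintegral_indicator (hm _ hs), ← lintegral_indicator (hm _ hs), hind_mul, hind_mul]
  calc ∫⁻ ω, ind ω * φ (Y ω + W ω) ∂μ
      = ∫⁻ p, p.1.1 * φ (p.1.2 + p.2) ∂(μ.map fun ω => (P ω, W ω)) :=
        (lintegral_map hψ (hP0.prodMk hW)).symm
    _ = ∫⁻ p, ∫⁻ z, p.1 * φ (p.2 + z) ∂(μ.map W) ∂(μ.map P) := by
        rw [hprod, lintegral_prod _ hψ.aemeasurable]
    _ = ∫⁻ ω, ∫⁻ z, ind ω * φ (Y ω + z) ∂(μ.map W) ∂μ := lintegral_map hG hP0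
    _ = ∫⁻ ω, ind ω * ∫⁻ z, φ (Y ω + z) ∂(μ.map W) ∂μ := by
        refine lintegral_congr fun ω => lintegral_const_mul _ (by fun_prop)

/-- A Ville-type bound: if `V` grows by at most `β` in mean per step on the surviving event `s k`,
and `V ≥ 1` upon leaving, then the probability of leaving is controlled by the initial value. -/
theorem measure_compl_add_setLIntegral_le {Ω : Type*} {m0 : MeasurableSpace Ω} {μ : Measure Ω}
    {s : ℕ → Set Ω} (hs : ∀ k, MeasurableSet (s k)) (hanti : Antitone s)
    {V : ℕ → Ω → ENNReal} {β : ENNReal} {K : ℕ}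
    (hexit : ∀ k, ∀ ω ∈ s k \ s (k + 1), 1 ≤ V (k + 1) ω)
    (hstep : ∀ k < K, ∫⁻ ω in s k, V (k + 1) ω ∂μ ≤ ∫⁻ ω in s k, V k ω ∂μ + β) :
    μ (s K)ᶜ + ∫⁻ ω in s K, V K ω ∂μ ≤ μ (s 0)ᶜ + ∫⁻ ω in s 0, V 0 ω ∂μ + K * β := by
  suffices ∀ k ≤ K, μ (s k)ᶜ + ∫⁻ ω in s k, V k ω ∂μ ≤
      μ (s 0)ᶜ + ∫⁻ ω in s 0, V 0 ω ∂μ + k * β from this K le_rfl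
  intro k
  induction k with
  | zero => simp
  | succ k ih =>
    intro hk
    have hsub : s (k + 1) ⊆ s k := hanti k.le_succ
    have hcompl : (s (k + 1))ᶜ ⊆ (s k)ᶜ ∪ (s k \ s (k + 1)) := by
      intro ω hω
      by_cases h : ω ∈ s k
      · exact Or.inr ⟨h, hω⟩
      · exact Or.inl h
    have hleave : μ (s k \ s (k + 1)) ≤ ∫⁻ ω in s k \ s (k + 1), V (k + 1) ω ∂μ := by
      rw [← setLIntegral_one]
      exact setLIntegral_mono' ((hs k).diff (hs (k + 1))) (hexit k)
    have hsplit : ∫⁻ ω in s k \ s (k + 1), V (k + 1) ω ∂μ + ∫⁻ ω in s (k + 1), V (k + 1) ω ∂μ =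
        ∫⁻ ω in s k, V (k + 1) ω ∂μ := by
      rw [← lintegral_inter_add_sdiff _ (s k) (hs (k + 1)), Set.inter_eq_right.mpr hsub, add_comm]
    calc μ (s (k + 1))ᶜ + ∫⁻ ω in s (k + 1), V (k + 1) ω ∂μ
        ≤ (μ (s k)ᶜ + ∫⁻ ω in s k \ s (k + 1), V (k + 1) ω ∂μ) +
            ∫⁻ ω in s (k + 1), V (k + 1) ω ∂μ := by
          gcongr
          exact (measure_mono hcompl).trans ((measure_union_le _ _).trans (by gcongr))
      _ = μ (s k)ᶜ + ∫⁻ ω in s k, V (k + 1) ω ∂μ := by rw [add_assoc, hsplit]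
      _ ≤ μ (s k)ᶜ + ∫⁻ ω in s k, V k ω ∂μ + β := by
          rw [add_assoc]
          gcongr
          exact hstep k hk
      _ ≤ μ (s 0)ᶜ + ∫⁻ ω in s 0, V 0 ω ∂μ + k * β + β := by
          exact add_le_add_left (ih (Nat.le_of_succ_le hk)) β
      _ = μ (s 0)ᶜ + ∫⁻ ω in s 0, V 0 ω ∂μ + (k + 1 : ℕ) * β := by
          push_cast
          ring

/-- Completing the square in the exponent of the shifted Gaussian expectation of `exp (-h)`. -/
theorem quadratic_complete_square {n : ℕ} {A P : Matrix (Fin n) (Fin n) ℝ} (hA : A.IsSymm)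
    (hL : ((2 : ℝ)⁻¹ • P + A).PosDef) (b F z : Fin n → ℝ) (c : ℝ) :
    (F + z) ⬝ᵥ A.mulVec (F + z) + b ⬝ᵥ (F + z) + c + (1 / 2 : ℝ) * (z ⬝ᵥ P.mulVec z) =
      (F ⬝ᵥ A.mulVec F + b ⬝ᵥ F + c -
        (A.mulVec F + (2 : ℝ)⁻¹ • b) ⬝ᵥ
          ((2 : ℝ)⁻¹ • P + A)⁻¹.mulVec (A.mulVec F + (2 : ℝ)⁻¹ • b)) +
      (z + ((2 : ℝ)⁻¹ • P + A)⁻¹.mulVec (A.mulVec F + (2 : ℝ)⁻¹ • b)) ⬝ᵥ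
        ((2 : ℝ)⁻¹ • P + A).mulVec
          (z + ((2 : ℝ)⁻¹ • P + A)⁻¹.mulVec (A.mulVec F + (2 : ℝ)⁻¹ • b)) := by
  set L := (2 : ℝ)⁻¹ • P + A with hLdef
  set v := A.mulVec F + (2 : ℝ)⁻¹ • b with hv
  set q := L⁻¹.mulVec v with hq
  have hsymm : ∀ {B : Matrix (Fin n) (Fin n) ℝ}, B.IsSymm → ∀ y y',
      y ⬝ᵥ B.mulVec y' = y' ⬝ᵥ B.mulVec y := by
    intro B hB y y'
    rw [dotProduct_mulVec, ← mulVec_transpose, hB.eq, dotProduct_comm]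
  have hLs : L.IsSymm := by
    have := hL.1.eq
    rwa [conjTranspose_eq_transpose_of_trivial] at this
  have hLq : L.mulVec q = v := by
    rw [hq, mulVec_mulVec, mul_nonsing_inv _ hL.det_pos.ne'.isUnit, one_mulVec]
  have hzL : z ⬝ᵥ L.mulVec z = (1 / 2 : ℝ) * (z ⬝ᵥ P.mulVec z) + z ⬝ᵥ A.mulVec z := by
    rw [hLdef, add_mulVec, dotProduct_add, smul_mulVec, dotProduct_smul, smul_eq_mul]
    ring
  have hzv : z ⬝ᵥ v = z ⬝ᵥ A.mulVec F + (1 / 2 : ℝ) * (b ⬝ᵥ z) := by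
    rw [hv, dotProduct_add, dotProduct_smul, smul_eq_mul, dotProduct_comm z b]
    ring
  have hqz : q ⬝ᵥ L.mulVec z = z ⬝ᵥ v := by rw [hsymm hLs, hLq]
  have hFz := hsymm hA F z
  simp only [mulVec_add, dotProduct_add, add_dotProduct, hLq, hqz, hFz, hzL, hzv]
  rw [dotProduct_comm q v]
  ring

theorem lintegral_exp_neg_quadratic_gaussianMeasure {n : ℕ} {S A : Matrix (Fin n) (Fin n) ℝ}
    (hS : S.PosDef) (hA : A.IsSymm) (hL : ((2 : ℝ)⁻¹ • S⁻¹ + A).PosDef) (b F : Fin n → ℝ) (c : ℝ) :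
    ∫⁻ z, ENNReal.ofReal
        (Real.exp (-((F + z) ⬝ᵥ A.mulVec (F + z) + b ⬝ᵥ (F + z) + c))) ∂(gaussianMeasure S) =
      ENNReal.ofReal (Real.exp (-(F ⬝ᵥ A.mulVec F + b ⬝ᵥ F + c -
        (A.mulVec F + (2 : ℝ)⁻¹ • b) ⬝ᵥ
          ((2 : ℝ)⁻¹ • S⁻¹ + A)⁻¹.mulVec (A.mulVec F + (2 : ℝ)⁻¹ • b)) -
        (1 / 2 : ℝ) * Real.log (1 + (2 : ℝ) • (S * A)).det)) := by
  set L := (2 : ℝ)⁻¹ • S⁻¹ + A with hLdef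
  set H := F ⬝ᵥ A.mulVec F + b ⬝ᵥ F + c - (A.mulVec F + (2 : ℝ)⁻¹ • b) ⬝ᵥ
    L⁻¹.mulVec (A.mulVec F + (2 : ℝ)⁻¹ • b) with hH
  set q := L⁻¹.mulVec (A.mulVec F + (2 : ℝ)⁻¹ • b) with hq
  set C := (2 * Real.pi) ^ (-(n : ℝ) / 2) * S.det ^ (-(1 : ℝ) / 2) with hC
  have hSdet := hS.det_pos
  have hLdet := hL.det_pos
  have hC0 : 0 ≤ C := by positivity
  have hdet : (1 + (2 : ℝ) • (S * A)).det = 2 ^ n * S.det * L.det := by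
    have : 1 + (2 : ℝ) • (S * A) = (2 : ℝ) • (S * L) := by
      rw [hLdef, mul_add, Matrix.mul_smul, mul_nonsing_inv _ hSdet.ne'.isUnit, smul_add, smul_smul]
      norm_num
    rw [this, det_smul, det_mul, Fintype.card_fin, mul_assoc]
  have hpi := Real.pi_pos
  have hconst : C * (√Real.pi ^ n * (√L.det)⁻¹) =
      Real.exp (-((1 / 2 : ℝ) * Real.log (1 + (2 : ℝ) • (S * A)).det)) := by
    have hpos : 0 < C * (√Real.pi ^ n * (√L.det)⁻¹) := by positivity
    rw [← Real.exp_log hpos, hdet, hC]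
    congr 1
    rw [Real.log_mul (by positivity) (by positivity), Real.log_mul (by positivity) (by positivity),
      Real.log_mul (by positivity) (by positivity), Real.log_mul (by positivity) (by positivity),
      Real.log_mul (by positivity) (by positivity), Real.log_rpow (by positivity),
      Real.log_rpow (by positivity), Real.log_mul (by positivity) (by positivity),
      Real.log_pow, Real.log_pow, Real.log_inv, Real.log_sqrt hpi.le, Real.log_sqrt hLdet.le]
    ring
  have hexp : ∀ z, ENNReal.ofReal (C * Real.exp (-(1 / 2 : ℝ) * (z ⬝ᵥ S⁻¹.mulVec z))) *
      ENNReal.ofReal (Real.exp (-((F + z) ⬝ᵥ A.mulVec (F + z) + b ⬝ᵥ (F + z) + c))) =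
      ENNReal.ofReal (C * Real.exp (-H)) *
        ENNReal.ofReal (Real.exp (-((z + q) ⬝ᵥ L.mulVec (z + q)))) := by
    intro z
    rw [← ENNReal.ofReal_mul (by positivity), ← ENNReal.ofReal_mul (by positivity),
      mul_assoc C, mul_assoc C, ← Real.exp_add, ← Real.exp_add]
    have hsq := quadratic_complete_square hA hL b F z c
    rw [← hLdef, ← hq, ← hH] at hsq
    congr 3
    linarith
  rw [gaussianMeasure, lintegral_withDensity_eq_lintegral_mul]
  · simp only [Pi.mul_apply]
    simp_rw [← hC, hexp]
    rw [lintegral_const_mul, lintegral_add_right_eq_self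
        (fun z => ENNReal.ofReal (Real.exp (-(z ⬝ᵥ L.mulVec z)))) q,
      lintegral_exp_neg_quadratic hL, ← ENNReal.ofReal_mul (by positivity), mul_right_comm, hconst,
      ← Real.exp_add]
    · congr 2
      ring
    · fun_prop
  · fun_prop
  · fun_prop

/-- **Quadratic-CBF exit bound** (Theorem 6): for the quadratic CBF
`h(x) = xᵀ A x + bᵀ x + c` with `Λ = (1/2)Σ⁻¹ + A` positive definite, if along the
closed-loop trajectory the condition
`h(F_k) - Θ(F_k) ≥ -log(exp(-h(x_k)) + β) - M` (with `F_k = f(x_k) + g(x_k)u_k`,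
`Θ(F) = (AF + b/2)ᵀ Λ⁻¹ (AF + b/2)`, `M = (1/2) log det(I + 2ΣA)`) holds a.s. on the
event that the trajectory has stayed in the safe set `𝓒 = {h ≥ 0}` up to time `k`, then
the `K`-step exit probability is bounded by `exp(-h(x_0)) + Kβ`. -/
theorem quadratic_cbf_exit_bound
    {n m K : ℕ} {Ω : Type*} {m0 : MeasurableSpace Ω} {μ : Measure Ω}
    [IsProbabilityMeasure μ] (𝓕 : Filtration ℕ m0)
    (f : (Fin n → ℝ) → Fin n → ℝ) (g : (Fin n → ℝ) → Matrix (Fin n) (Fin m) ℝ)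
    (hf : Continuous f) (hg : Continuous g)
    (u : ℕ → Ω → Fin m → ℝ) (w : ℕ → Ω → Fin n → ℝ) (x : ℕ → Ω → Fin n → ℝ)
    (S : Matrix (Fin n) (Fin n) ℝ) (hSsymm : S.IsSymm) (hSpd : S.PosDef)
    (hu : ∀ k, Measurable[𝓕 k] (u k))
    (hw_meas : ∀ k, Measurable[𝓕 (k + 1)] (w k))
    (hw_indep : ∀ k, Indep (MeasurableSpace.comap (w k) inferInstance) (𝓕 k) μ)
    (hw_law : ∀ k, μ.map (w k) = gaussianMeasure S)
    (hx : Adapted 𝓕 x)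
    (hdyn : ∀ k ω, x (k + 1) ω = f (x k ω) + (g (x k ω)).mulVec (u k ω) + w k ω)
    (A : Matrix (Fin n) (Fin n) ℝ) (hAsymm : A.IsSymm) (b : Fin n → ℝ) (c : ℝ)
    (hΛpd : ((2 : ℝ)⁻¹ • S⁻¹ + A).PosDef)
    (h : (Fin n → ℝ) → ℝ) (hhdef : ∀ y, h y = y ⬝ᵥ A.mulVec y + b ⬝ᵥ y + c)
    (Θ : (Fin n → ℝ) → ℝ)
    (hΘdef : ∀ F, Θ F = (A.mulVec F + (2 : ℝ)⁻¹ • b) ⬝ᵥ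
      ((2 : ℝ)⁻¹ • S⁻¹ + A)⁻¹.mulVec (A.mulVec F + (2 : ℝ)⁻¹ • b))
    (M : ℝ) (hMdef : M = (1 / 2 : ℝ) * Real.log (1 + (2 : ℝ) • (S * A)).det)
    (β : ℝ) (hβ : 0 ≤ β)
    (x0 : Fin n → ℝ) (hx0 : ∀ ω, x 0 ω = x0) (hx0C : 0 ≤ h x0)
    (hcbf : ∀ k, k < K → ∀ᵐ ω ∂μ,
      (∀ j, j ≤ k → 0 ≤ h (x j ω)) →
        h (f (x k ω) + (g (x k ω)).mulVec (u k ω)) -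
            Θ (f (x k ω) + (g (x k ω)).mulVec (u k ω)) ≥
          -Real.log (Real.exp (-h (x k ω)) + β) - M) :
    μ {ω | ∃ k, k ≤ K ∧ h (x k ω) < 0} ≤
      ENNReal.ofReal (Real.exp (-h x0) + (K : ℝ) * β) := by
  have hh : h = fun y => y ⬝ᵥ A.mulVec y + b ⬝ᵥ y + c := funext hhdef
  have hhc : Continuous h := by
    rw [hh]
    fun_prop
  have hxm : ∀ j k, j ≤ k → Measurable[𝓕 k] (x j) := fun j k hjk => (hx j).mono (𝓕.mono hjk) le_rfl
  let s : ℕ → Set Ω := fun k => {ω | ∀ j, j ≤ k → 0 ≤ h (x j ω)}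
  have hsF : ∀ k, MeasurableSet[𝓕 k] (s k) := by
    intro k
    have : s k = ⋂ j, ⋂ (_ : j ≤ k), {ω | 0 ≤ h (x j ω)} := by
      ext ω
      simp [s]
    rw [this]
    exact MeasurableSet.iInter fun j => MeasurableSet.iInter fun hj =>
      hxm j k hj (measurableSet_le measurable_const hhc.measurable)
  have hs : ∀ k, MeasurableSet (s k) := fun k => 𝓕.le k _ (hsF k)
  have hanti : Antitone s := fun i j hij ω hω l hl => hω l (hl.trans hij)
  let V : ℕ → Ω → ENNReal := fun k ω => ENNReal.ofReal (Real.exp (-h (x k ω)))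
  have hexit : ∀ k, ∀ ω ∈ s k \ s (k + 1), 1 ≤ V (k + 1) ω := by
    rintro k ω ⟨hω, hω'⟩
    have hneg : h (x (k + 1) ω) < 0 := by
      by_contra! hnn
      refine hω' fun j hj => ?_
      rcases Nat.le_succ_iff.mp hj with hj | rfl
      · exact hω j hj
      · exact hnn
    rw [ENNReal.one_le_ofReal]
    exact Real.one_le_exp (by linarith)
  have hstep : ∀ k < K, ∫⁻ ω in s k, V (k + 1) ω ∂μ ≤
      ∫⁻ ω in s k, V k ω ∂μ + ENNReal.ofReal β := by
    intro k hk
    let F : Ω → Fin n → ℝ := fun ω => f (x k ω) + (g (x k ω)).mulVec (u k ω)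
    have hF : Measurable[𝓕 k] F := by
      have hcont : Continuous fun p : (Fin n → ℝ) × (Fin m → ℝ) =>
          f p.1 + (g p.1).mulVec p.2 := by fun_prop
      exact hcont.measurable.comp ((hx k).prodMk (hu k))
    have hφ : Measurable fun y => ENNReal.ofReal (Real.exp (-h y)) := by
      have := hhc.measurable
      fun_prop
    calc ∫⁻ ω in s k, V (k + 1) ω ∂μ
        = ∫⁻ ω in s k, ENNReal.ofReal (Real.exp (-h (F ω + w k ω))) ∂μ := by simp only [V, F, hdyn]
      _ = ∫⁻ ω in s k, ∫⁻ z, ENNReal.ofReal (Real.exp (-h (F ω + z))) ∂(μ.map (w k)) ∂μ :=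
          setLIntegral_add_of_indep (𝓕.le k) (hsF k) hF ((hw_meas k).mono (𝓕.le _) le_rfl)
            (hw_indep k) hφ
      _ = ∫⁻ ω in s k, ENNReal.ofReal (Real.exp (-(h (F ω) - Θ (F ω)) - M)) ∂μ := by
          simp only [hw_law, hhdef, hΘdef, hMdef,
            lintegral_exp_neg_quadratic_gaussianMeasure hSpd hAsymm hΛpd]
      _ ≤ ∫⁻ ω in s k, (V k ω + ENNReal.ofReal β) ∂μ := by
          refine setLIntegral_mono_ae' (hs k) ?_
          filter_upwards [hcbf k hk] with ω hω hωs
          have hpos : 0 < Real.exp (-h (x k ω)) + β := by positivity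
          rw [← ENNReal.ofReal_add (Real.exp_pos _).le hβ]
          refine ENNReal.ofReal_le_ofReal ?_
          rw [← Real.le_log_iff_exp_le hpos]
          linarith [hω hωs]
      _ = ∫⁻ ω in s k, V k ω ∂μ + ENNReal.ofReal β * μ (s k) := by
          rw [lintegral_add_right _ measurable_const, setLIntegral_const]
      _ ≤ ∫⁻ ω in s k, V k ω ∂μ + ENNReal.ofReal β := by
          gcongr
          exact mul_le_of_le_one_right' prob_le_one
  have hs0 : s 0 = Set.univ := by
    ext ω
    simp [s, hx0, hx0C]
  have hset : {ω | ∃ k, k ≤ K ∧ h (x k ω) < 0} = (s K)ᶜ := by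
    ext ω
    simp [s]
  have hV0 : ∫⁻ ω in s 0, V 0 ω ∂μ = ENNReal.ofReal (Real.exp (-h x0)) := by simp [V, hs0, hx0]
  rw [hset, ENNReal.ofReal_add (Real.exp_pos _).le (by positivity),
    ENNReal.ofReal_mul (Nat.cast_nonneg K), ENNReal.ofReal_natCast, ← hV0]
  refine le_self_add.trans ((measure_compl_add_setLIntegral_le hs hanti hexit hstep).trans ?_)
  simp [hs0]
end
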